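/- arXiv:2104.11865 — 13 statements merged into one kernel-verified Lean document; each statement's English description precedes it below -/
import Mathlib

section
/- For every real number a > 0 and every suboptimality ratio α ≥ (2a+1)/(2a), there exists a constant C > 0 (depending only on a and α) such that for every θ ≥ 1 there is a finite set 𝒞 ⊆ ℝ with cardinality at most C·log θ + 1 that is an α-suboptimal cover of the interval [1/θ, 1]; in particular the α-suboptimal covering number of [1/θ, 1] is O(log θ). -/
/-- Scalar LQR closed-loop cost for controller `k` on system `(a, b)`. -/
noncomputable def scalarJ (a b k : ℝ) : ℝ := (1 + k^2) / (-2 * (a + b * k))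

/-- Optimal scalar LQR cost for system `(a, b)`. -/
noncomputable def scalarJStar (a b : ℝ) : ℝ := (a + Real.sqrt (a^2 + b^2)) / b^2

/-- `C` is an `α`-suboptimal cover of `B` for the scalar LQR problem with drift `a`. -/
def IsSuboptCover (a α : ℝ) (B : Set ℝ) (C : Finset ℝ) : Prop :=
  ∀ b ∈ B, ∃ k ∈ C, a + b * k < 0 ∧ scalarJ a b k ≤ α * scalarJStar a b

/-- The optimal controller of the system `(a, b₀)`. -/
noncomputable def scalarOptController (a b₀ : ℝ) : ℝ := -(a + Real.sqrt (a ^ 2 + b₀ ^ 2)) / b₀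

/-- The optimal controller of `(a, b₀)` leaves a stability margin of at least
`√(a² + b₀²)` on every system `(a, b)` with `b₀ ≤ b`. -/
lemma add_mul_scalarOptController_le {a b₀ b : ℝ} (ha : 0 < a) (hb₀ : 0 < b₀) (hb : b₀ ≤ b) :
    a + b * scalarOptController a b₀ ≤ -Real.sqrt (a ^ 2 + b₀ ^ 2) := by
  have hs := Real.sqrt_nonneg (a ^ 2 + b₀ ^ 2)
  have hratio : 1 ≤ b / b₀ := (one_le_div hb₀).2 hb
  have hk : b * scalarOptController a b₀ = -(b / b₀ * (a + Real.sqrt (a ^ 2 + b₀ ^ 2))) := by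
    unfold scalarOptController
    ring
  rw [hk]
  nlinarith

/-- The optimal controller of `(a, b₀)` is `α`-suboptimal on `(a, b)` whenever
`b₀ ≤ b` and `b² ≤ α b₀²`. -/
lemma scalarJ_scalarOptController_le {a b₀ b α : ℝ} (ha : 0 < a) (hb₀ : 0 < b₀) (hb : b₀ ≤ b)
    (hα : b ^ 2 ≤ α * b₀ ^ 2) :
    scalarJ a b (scalarOptController a b₀) ≤ α * scalarJStar a b := by
  have hmargin := add_mul_scalarOptController_le ha hb₀ hb
  have hbpos : 0 < b := hb₀.trans_le hb
  have hs : 0 < Real.sqrt (a ^ 2 + b₀ ^ 2) := Real.sqrt_pos.2 (by positivity)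
  have hsq : Real.sqrt (a ^ 2 + b₀ ^ 2) ^ 2 = a ^ 2 + b₀ ^ 2 := Real.sq_sqrt (by positivity)
  have hmono : Real.sqrt (a ^ 2 + b₀ ^ 2) ≤ Real.sqrt (a ^ 2 + b ^ 2) :=
    Real.sqrt_le_sqrt (by gcongr)
  have hα0 : 0 ≤ α := nonneg_of_mul_nonneg_left ((sq_nonneg b).trans hα) (by positivity)
  calc scalarJ a b (scalarOptController a b₀)
      ≤ (1 + scalarOptController a b₀ ^ 2) / (2 * Real.sqrt (a ^ 2 + b₀ ^ 2)) := by
        unfold scalarJ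
        exact div_le_div_of_nonneg_left (by positivity) (by positivity) (by linarith)
    _ = (a + Real.sqrt (a ^ 2 + b₀ ^ 2)) / b₀ ^ 2 := by
        unfold scalarOptController
        field_simp
        linear_combination -hsq
    _ ≤ α * (a + Real.sqrt (a ^ 2 + b₀ ^ 2)) / b ^ 2 := by
        rw [div_le_div_iff₀ (by positivity) (by positivity)]
        nlinarith [mul_le_mul_of_nonneg_left hα (add_pos ha hs).le]
    _ ≤ α * scalarJStar a b := by
        unfold scalarJStar
        rw [mul_div_assoc]
        gcongr

theorem stmt0 (a α : ℝ) (ha : 0 < a) (hα : (2 * a + 1) / (2 * a) ≤ α) :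
    ∃ C : ℝ, 0 < C ∧ ∀ θ : ℝ, 1 ≤ θ →
      ∃ 𝒞 : Finset ℝ, (𝒞.card : ℝ) ≤ C * Real.log θ + 1 ∧
        IsSuboptCover a α (Set.Icc (1 / θ) 1) 𝒞 := by
  have hα1 : 1 < α := lt_of_lt_of_le ((one_lt_div (by positivity)).2 (by linarith)) hα
  set r := Real.sqrt α with hr
  have hr1 : 1 < r := Real.lt_sqrt_of_sq_lt (by linarith)
  have hrα : r ^ 2 = α := Real.sq_sqrt (by linarith)
  have hlog : 0 < Real.log r := Real.log_pos hr1
  refine ⟨1 / Real.log r, by positivity, fun θ hθ => ?_⟩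
  have hθ0 : 0 < θ := by linarith
  have hlogθ : 0 ≤ Real.log θ := Real.log_nonneg hθ
  refine ⟨(Finset.range (⌊Real.log θ / Real.log r⌋₊ + 1)).image
    fun n => scalarOptController a (r ^ n / θ), ?_, ?_⟩
  · calc _ ≤ ((⌊Real.log θ / Real.log r⌋₊ + 1 : ℕ) : ℝ) := by
          exact_mod_cast Finset.card_image_le.trans_eq (Finset.card_range _)
      _ ≤ 1 / Real.log r * Real.log θ + 1 := by
          have := Nat.floor_le (div_nonneg hlogθ hlog.le)
          push_cast
          rw [one_div_mul_eq_div]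
          linarith
  · rintro b ⟨hb, hb1⟩
    obtain ⟨n, hn, hn'⟩ := exists_nat_pow_near ((div_le_iff₀ hθ0).1 hb) hr1
    have hb₀ : 0 < r ^ n / θ := by positivity
    have hle : r ^ n / θ ≤ b := (div_le_iff₀ hθ0).2 hn
    have hlt : b ≤ r * (r ^ n / θ) := by
      rw [← mul_div_assoc, le_div_iff₀ hθ0, ← pow_succ']
      exact hn'.le
    refine ⟨_, Finset.mem_image_of_mem _ (a := n) ?_,
      (add_mul_scalarOptController_le ha hb₀ hle).trans_lt
        (neg_neg_of_pos (Real.sqrt_pos.2 (by positivity))),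
      scalarJ_scalarOptController_le ha hb₀ hle ?_⟩
    · rw [Finset.mem_range, Nat.lt_succ_iff]
      apply Nat.le_floor
      rw [le_div_iff₀ hlog, ← Real.log_pow]
      exact Real.log_le_log (by positivity) (hn.trans (mul_le_of_le_one_left hθ0.le hb1))
    · rw [← hrα, ← mul_pow]
      exact pow_le_pow_left₀ (hb₀.le.trans hle) hlt 2
end

section
/- Let a = 1 and α ≥ 3/2. There exist constants c > 0 and θ₀ ≥ 1 (depending only on α) such that for every θ ≥ θ₀, every finite set 𝒞 ⊆ ℝ that is an α-suboptimal cover of the interval [1/θ, 1] satisfies |𝒞| ≥ c·log θ; in particular the α-suboptimal covering number of [1/θ, 1] is Ω(log θ). -/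
/-- A controller that is `α`-suboptimal at `b` has gain `-k` between `1 / b` and `6 * α / b`. -/
lemma gain_bounds_of_scalarJ_le {α b k : ℝ} (hα : 0 ≤ α) (hb : 0 < b) (hb1 : b ≤ 1)
    (hk : 1 + b * k < 0) (h : scalarJ 1 b k ≤ α * scalarJStar 1 b) :
    1 < b * -k ∧ b * -k < 6 * α := by
  have ht : 1 < b * -k := by linarith
  refine ⟨ht, ?_⟩
  have hsqrt : Real.sqrt (1 ^ 2 + b ^ 2) ≤ 2 :=
    Real.sqrt_le_iff.mpr ⟨by norm_num, by nlinarith⟩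
  have hstar : scalarJStar 1 b ≤ 3 / b ^ 2 := by
    unfold scalarJStar
    gcongr
    linarith
  have hcost : (1 + k ^ 2) / (-2 * (1 + b * k)) ≤ 3 * α / b ^ 2 :=
    (h.trans (mul_le_mul_of_nonneg_left hstar hα)).trans_eq (by ring)
  rw [div_le_div_iff₀ (by linarith) (by positivity)] at hcost
  by_contra! hge
  nlinarith [mul_le_mul_of_nonneg_left hge (by linarith : 0 ≤ b * -k), pow_pos hb 2]

/-- A cover of `[1 / θ, 1]` has at least `N + 1` elements whenever `(6 * α) ^ N ≤ θ`. -/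
lemma IsSuboptCover.succ_le_card {α θ : ℝ} (hα : 3 / 2 ≤ α) {C : Finset ℝ}
    (hC : IsSuboptCover 1 α (Set.Icc (1 / θ) 1) C) {N : ℕ} (hN : (6 * α) ^ N ≤ θ) :
    N + 1 ≤ C.card := by
  have hR : 1 ≤ 6 * α := by linarith
  have hmem : ∀ i ∈ Finset.range (N + 1), 1 / (6 * α) ^ i ∈ Set.Icc (1 / θ) 1 := by
    intro i hi
    have hi' : (6 * α) ^ i ≤ θ :=
      (pow_le_pow_right₀ hR (Nat.lt_succ_iff.mp (Finset.mem_range.mp hi))).trans hN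
    exact ⟨one_div_le_one_div_of_le (by positivity) hi',
      div_le_one_of_le₀ (one_le_pow₀ hR) (by positivity)⟩
  choose! f hf using fun i hi => hC _ (hmem i hi)
  have hbounds : ∀ i ∈ Finset.range (N + 1),
      (6 * α) ^ i < -f i ∧ -f i < (6 * α) ^ (i + 1) := by
    intro i hi
    have hpos : 0 < (6 * α) ^ i := by positivity
    obtain ⟨h₁, h₂⟩ := gain_bounds_of_scalarJ_le (by linarith) (by positivity) (hmem i hi).2
      (hf i hi).2.1 (hf i hi).2.2
    rw [one_div_mul_eq_div] at h₁ h₂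
    exact ⟨(one_lt_div hpos).mp h₁, by rw [pow_succ']; exact (div_lt_iff₀ hpos).mp h₂⟩
  have hle : ∀ i ∈ Finset.range (N + 1), ∀ j ∈ Finset.range (N + 1), f i = f j → i ≤ j := by
    intro i hi j hj hij
    by_contra! hlt
    have : (6 * α) ^ (j + 1) ≤ (6 * α) ^ i := pow_le_pow_right₀ hR hlt
    linarith [(hbounds i hi).1, (hbounds j hj).2]
  simpa using Finset.card_le_card_of_injOn f (fun i hi => (hf i hi).1)
    fun i hi j hj hij => le_antisymm (hle i hi j hj hij) (hle j hj i hi hij.symm)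

theorem stmt1 (α : ℝ) (hα : 3 / 2 ≤ α) :
    ∃ c : ℝ, 0 < c ∧ ∃ θ₀ : ℝ, 1 ≤ θ₀ ∧ ∀ θ : ℝ, θ₀ ≤ θ →
      ∀ 𝒞 : Finset ℝ, IsSuboptCover 1 α (Set.Icc (1 / θ) 1) 𝒞 →
        c * Real.log θ ≤ (𝒞.card : ℝ) := by
  have hlog : 0 < Real.log (6 * α) := Real.log_pos (by linarith)
  refine ⟨1 / Real.log (6 * α), by positivity, 1, le_rfl, fun θ hθ 𝒞 h𝒞 => ?_⟩
  have hfloor := Nat.floor_le (div_nonneg (Real.log_nonneg hθ) hlog.le)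
  have hpow : (6 * α) ^ ⌊Real.log θ / Real.log (6 * α)⌋₊ ≤ θ := by
    rw [← Real.log_le_log_iff (by positivity) (by positivity), Real.log_pow]
    exact (le_div_iff₀ hlog).mp hfloor
  have hcard : ((⌊Real.log θ / Real.log (6 * α)⌋₊ + 1 : ℕ) : ℝ) ≤ 𝒞.card :=
    Nat.cast_le.mpr (h𝒞.succ_le_card hα hpow)
  push_cast at hcard
  rw [one_div_mul_eq_div]
  exact (Nat.lt_floor_add_one _).le.trans hcard
end

section
/- Let a ≥ 1, α ≥ 3/2, k < 0, and 0 < b ≤ 1. If a + b·k < 0 and (1 + k²)/(−2(a + b·k)) ≤ α · (a + √(a² + b²))/b², then b lies in the interval [(c₁ − c₂)/(−k), (c₁ + c₂)/(−k)], where c₁ := 3αa and c₂ := a·√(9α² − 6α). In other words, the α-suboptimal neighborhood of the controller k is contained in (1/|k|)·[c₁ − c₂, c₁ + c₂]. -/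
theorem stmt4 (a α k b : ℝ) (ha : 1 ≤ a) (hα : 3 / 2 ≤ α) (hk : k < 0)
    (hb0 : 0 < b) (hb1 : b ≤ 1)
    (hstab : a + b * k < 0)
    (hsub : (1 + k^2) / (-2 * (a + b * k)) ≤ α * ((a + Real.sqrt (a^2 + b^2)) / b^2)) :
    b ∈ Set.Icc ((3 * α * a - a * Real.sqrt (9 * α^2 - 6 * α)) / (-k))
               ((3 * α * a + a * Real.sqrt (9 * α^2 - 6 * α)) / (-k)) := by
  have hsqrt : Real.sqrt (a^2 + b^2) ≤ 2 * a :=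
    Real.sqrt_le_iff.mpr ⟨by linarith, by nlinarith⟩
  have hcost : (1 + k^2) / (-2 * (a + b * k)) ≤ (α * (3 * a)) / b^2 := by
    refine hsub.trans ?_
    rw [← mul_div_assoc]
    gcongr
    linarith
  rw [div_le_div_iff₀ (by linarith) (by positivity)] at hcost
  have hs : Real.sqrt (9 * α^2 - 6 * α) ^ 2 = 9 * α^2 - 6 * α :=
    Real.sq_sqrt (by nlinarith)
  have hsq : (b * (-k) - 3 * α * a) ^ 2 ≤ (a * Real.sqrt (9 * α^2 - 6 * α)) ^ 2 := by
    rw [mul_pow, hs]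
    nlinarith [sq_nonneg b]
  obtain ⟨hlower, hupper⟩ := abs_le_of_sq_le_sq' hsq (by positivity)
  exact ⟨(div_le_iff₀ (by linarith)).mpr (by linarith),
    (le_div_iff₀ (by linarith)).mpr (by linarith)⟩
end

section
/- Let a > 0, α > 1, θ ≥ 1, and k < −1. Then the set S(k) := { b ∈ [1/θ, 1] : a + b·k < 0 and (1 + k²)/(−2(a + b·k)) ≤ α·(a + √(a² + b²))/b² } is either empty or a closed interval [b₁, b₂] with 0 < b₁ ≤ b₂. -/
theorem convexOn_sqrt_sq_add_sq (a : ℝ) :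
    ConvexOn ℝ Set.univ (fun b : ℝ => Real.sqrt (a^2 + b^2)) := by
  refine ⟨convex_univ, fun x _ y _ s t hs ht hst => ?_⟩
  simp only [smul_eq_mul]
  have hu := Real.sqrt_nonneg (a^2 + x^2)
  have hv := Real.sqrt_nonneg (a^2 + y^2)
  have hu2 := Real.sq_sqrt (by positivity : 0 ≤ a^2 + x^2)
  have hv2 := Real.sq_sqrt (by positivity : 0 ≤ a^2 + y^2)
  set u := Real.sqrt (a^2 + x^2)
  set v := Real.sqrt (a^2 + y^2)
  have huv : a^2 + x * y ≤ u * v := by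
    refine (le_abs_self _).trans (abs_le_of_sq_le_sq ?_ (mul_nonneg hu hv))
    rw [mul_pow, hu2, hv2]
    nlinarith [sq_nonneg (a * (x - y))]
  apply Real.sqrt_le_iff.2 ⟨by positivity, ?_⟩
  have ha2 : a^2 = (s + t)^2 * a^2 := by rw [hst]; ring
  rw [ha2]
  have hmul := mul_le_mul_of_nonneg_left huv (mul_nonneg hs ht)
  linear_combination 2 * hmul - s^2 * hu2 - t^2 * hv2

/-- On positive `b`, the suboptimality condition says that a convex function of `b` lies below
an affine one. -/
theorem suboptimal_iff {a α k b : ℝ} (ha : 0 < a) (hα : 0 < α) (hb : 0 < b) :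
    (a + b * k < 0 ∧
      (1 + k^2) / (-2 * (a + b * k)) ≤ α * ((a + Real.sqrt (a^2 + b^2)) / b^2)) ↔
    (1 + k^2) * (Real.sqrt (a^2 + b^2) - a) ≤ 2 * α * (-(a + b * k)) := by
  have hr2 := Real.sq_sqrt (by positivity : 0 ≤ a^2 + b^2)
  have har : a < Real.sqrt (a^2 + b^2) := Real.lt_sqrt_of_sq_lt (by nlinarith)
  set r := Real.sqrt (a^2 + b^2)
  have hb2 : b^2 = (r - a) * (r + a) := by linear_combination -hr2
  have hra : 0 < r - a := sub_pos.2 har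
  have hrs : 0 < r + a := by linarith
  have hdiv : (a + r) / b^2 = 1 / (r - a) := by
    rw [hb2]
    field_simp
    ring
  have key (h : a + b * k < 0) :
      (1 + k^2) / (-2 * (a + b * k)) ≤ α * ((a + r) / b^2) ↔
        (1 + k^2) * (r - a) ≤ 2 * α * (-(a + b * k)) := by
    rw [hdiv, mul_one_div, div_le_div_iff₀ (by linarith) hra]
    ring_nf
  refine ⟨fun h => (key h.1).1 h.2, fun h => ?_⟩
  have hneg : a + b * k < 0 := by
    have hpos : 0 < (1 + k^2) * (r - a) := by positivity
    have := pos_of_mul_pos_right (hpos.trans_le h) (by positivity)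
    linarith
  exact ⟨hneg, (key hneg).2 h⟩

theorem stmt5 (a α θ k : ℝ) (ha : 0 < a) (hα : 1 < α) (hθ : 1 ≤ θ) (hk : k < -1) :
    let S : Set ℝ := { b ∈ Set.Icc (1 / θ) 1 |
      a + b * k < 0 ∧
      (1 + k^2) / (-2 * (a + b * k)) ≤ α * ((a + Real.sqrt (a^2 + b^2)) / b^2) }
    S = ∅ ∨ ∃ b₁ b₂ : ℝ, 0 < b₁ ∧ b₁ ≤ b₂ ∧ S = Set.Icc b₁ b₂ := by
  intro S
  have hθ' : 0 < 1 / θ := by positivity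
  set T : Set ℝ :=
    { b | (1 + k^2) * (Real.sqrt (a^2 + b^2) - a) ≤ 2 * α * (-(a + b * k)) }
  have hST : S = Set.Icc (1 / θ) 1 ∩ T := by
    ext b
    exact and_congr_right fun hb =>
      suboptimal_iff ha (by linarith) (hθ'.trans_le hb.1)
  have hTclosed : IsClosed T := isClosed_le (by fun_prop) (by fun_prop)
  have hTconvex : Convex ℝ T := by
    intro x hx y hy s t hs ht hst
    have hconv := (convexOn_sqrt_sq_add_sq a).2 (Set.mem_univ x) (Set.mem_univ y) hs ht hst
    simp only [T, Set.mem_ofPred_eq, smul_eq_mul] at hx hy hconv ⊢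
    have h := mul_le_mul_of_nonneg_left hconv (by positivity : 0 ≤ 1 + k^2)
    have hs' := mul_le_mul_of_nonneg_left hx hs
    have ht' := mul_le_mul_of_nonneg_left hy ht
    obtain rfl : t = 1 - s := by linarith
    linarith
  rcases S.eq_empty_or_nonempty with h | hne
  · exact Or.inl h
  right
  have hcompact : IsCompact S := hST ▸ isCompact_Icc.inter_right hTclosed
  have hconvex : Convex ℝ S := hST ▸ (convex_Icc _ _).inter hTconvex
  refine ⟨sInf S, sSup S, hθ'.trans_le (hcompact.sInf_mem hne).1.1,
    csInf_le hcompact.bddBelow (hcompact.sSup_mem hne),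
    eq_Icc_of_connected_compact ⟨hne, hconvex.isPreconnected⟩ hcompact⟩
end

section
/- Let a > 0, α > 1, θ ≥ 1, and let k ≤ k′ < −1. If the α-suboptimal neighborhoods S(k) and S(k′) within [1/θ, 1] are both nonempty, then their left endpoints and right endpoints are nondecreasing in the controller: sInf S(k) ≤ sInf S(k′) and sSup S(k) ≤ sSup S(k′). -/
/-- The `α`-suboptimal neighborhood of controller `k` within `[1/θ, 1]`. -/
noncomputable def suboptNbhd (a α θ k : ℝ) : Set ℝ :=
  { b ∈ Set.Icc (1 / θ) 1 |
    a + b * k < 0 ∧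
    (1 + k^2) / (-2 * (a + b * k)) ≤ α * ((a + Real.sqrt (a^2 + b^2)) / b^2) }

/-- The optimal controller of the scalar system `(a, b)` is `-optGain a b`. -/
noncomputable def optGain (a b : ℝ) : ℝ := (a + Real.sqrt (a^2 + b^2)) / b

lemma optGain_pos {a b : ℝ} (ha : 0 < a) (hb : 0 < b) : 0 < optGain a b := by
  unfold optGain; positivity

lemma mul_optGain_sq_sub_one {a b : ℝ} (hb : 0 < b) :
    b * ((optGain a b)^2 - 1) = 2 * optGain a b * a := by
  have hr : Real.sqrt (a^2 + b^2) ^ 2 = a^2 + b^2 := Real.sq_sqrt (by positivity)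
  unfold optGain
  field_simp
  linear_combination hr

lemma optGain_le_optGain {a b b' : ℝ} (ha : 0 < a) (hb : 0 < b) (h : b ≤ b') :
    optGain a b' ≤ optGain a b := by
  have hb' : 0 < b' := hb.trans_le h
  have hr : Real.sqrt (a^2 + b'^2) * b ≤ Real.sqrt (a^2 + b^2) * b' := by
    refine le_of_sq_le_sq ?_ (by positivity)
    rw [mul_pow, mul_pow, Real.sq_sqrt (by positivity), Real.sq_sqrt (by positivity)]
    have : a^2 * b^2 ≤ a^2 * b'^2 := by gcongr
    linarith
  unfold optGain
  rw [div_le_div_iff₀ hb' hb]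
  nlinarith

lemma cost_le_iff {a α b k : ℝ} (ha : 0 < a) (hα : 1 < α) (hb : 0 < b) :
    (a + b * k < 0 ∧
      (1 + k^2) / (-2 * (a + b * k)) ≤ α * ((a + Real.sqrt (a^2 + b^2)) / b^2)) ↔
    |optGain a b + k| ≤ Real.sqrt ((α - 1) / α) * Real.sqrt (1 + k^2) := by
  have hs := optGain_pos ha hb
  have hab := mul_optGain_sq_sub_one (a := a) hb
  have hJ : (a + Real.sqrt (a^2 + b^2)) / b^2 = optGain a b / b := by
    unfold optGain; field_simp
  rw [hJ]
  generalize optGain a b = s at hs hab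
  have hα0 : 0 < α := by linarith
  rw [← Real.sqrt_mul (div_nonneg (by linarith) hα0.le), ← Real.sqrt_sq_eq_abs,
    Real.sqrt_le_sqrt_iff (mul_nonneg (div_nonneg (by linarith) hα0.le) (by positivity)),
    div_mul_eq_mul_div, le_div_iff₀ hα0]
  have key : -2 * s * (a + b * k) = b * (1 - s^2 - 2 * s * k) := by
    linear_combination hab
  have hiff : a + b * k < 0 → ((1 + k^2) / (-2 * (a + b * k)) ≤ α * (s / b) ↔
      (s + k)^2 * α ≤ (α - 1) * (1 + k^2)) := by
    intro h
    rw [div_le_iff₀ (by linarith)]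
    have : α * (s / b) * (-2 * (a + b * k)) = α * (1 - s^2 - 2 * s * k) := by
      field_simp
      linear_combination key
    rw [this]
    constructor <;> intro h <;> linarith
  refine ⟨fun h => (hiff h.1).1 h.2, fun h => ?_⟩
  have hneg : a + b * k < 0 := by
    have h1 : 0 < α * (1 - s^2 - 2 * s * k) := by nlinarith [sq_nonneg k]
    have h2 : 0 < -2 * s * (a + b * k) := key ▸ mul_pos hb (pos_of_mul_pos_right h1 hα0.le)
    by_contra! hn
    nlinarith [mul_nonneg hs.le hn]
  exact ⟨hneg, (hiff hneg).2 h⟩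

lemma mem_suboptNbhd_iff {a α θ k b : ℝ} (ha : 0 < a) (hα : 1 < α) (hθ : 1 ≤ θ) :
    b ∈ suboptNbhd a α θ k ↔ b ∈ Set.Icc (1 / θ) 1 ∧
      |optGain a b + k| ≤ Real.sqrt ((α - 1) / α) * Real.sqrt (1 + k^2) := by
  refine and_congr_right fun h => cost_le_iff ha hα ?_
  exact (by positivity : 0 < 1 / θ).trans_le h.1

lemma abs_sqrt_one_add_sq_sub_le (x y : ℝ) :
    |Real.sqrt (1 + x^2) - Real.sqrt (1 + y^2)| ≤ |x - y| := by
  rw [← sq_le_sq]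
  have hx : Real.sqrt (1 + x^2) ^ 2 = 1 + x^2 := Real.sq_sqrt (by positivity)
  have hy : Real.sqrt (1 + y^2) ^ 2 = 1 + y^2 := Real.sq_sqrt (by positivity)
  have hxy : 1 + x * y ≤ Real.sqrt (1 + x^2) * Real.sqrt (1 + y^2) := by
    rw [← Real.sqrt_mul (by positivity)]
    exact Real.le_sqrt_of_sq_le (by nlinarith [sq_nonneg (x - y)])
  nlinarith

theorem stmt6 (a α θ k k' : ℝ) (ha : 0 < a) (hα : 1 < α) (hθ : 1 ≤ θ)
    (hkk' : k ≤ k') (hk' : k' < -1)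
    (hne : (suboptNbhd a α θ k).Nonempty) (hne' : (suboptNbhd a α θ k').Nonempty) :
    sInf (suboptNbhd a α θ k) ≤ sInf (suboptNbhd a α θ k') ∧
    sSup (suboptNbhd a α θ k) ≤ sSup (suboptNbhd a α θ k') := by
  have hpos : ∀ {κ b}, b ∈ suboptNbhd a α θ κ → 0 < b := fun h =>
    (by positivity : 0 < 1 / θ).trans_le h.1.1
  have hbelow : BddBelow (suboptNbhd a α θ k) := ⟨1 / θ, fun b h => h.1.1⟩
  have habove : BddAbove (suboptNbhd a α θ k') := ⟨1, fun b h => h.1.2⟩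
  have hdiff : |Real.sqrt ((α - 1) / α) * Real.sqrt (1 + k^2) -
      Real.sqrt ((α - 1) / α) * Real.sqrt (1 + k'^2)| ≤ k' - k := by
    have hc : Real.sqrt ((α - 1) / α) ≤ 1 := by
      rw [Real.sqrt_le_one, div_le_one (by linarith)]
      linarith
    rw [← mul_sub, abs_mul, abs_of_nonneg (Real.sqrt_nonneg _)]
    calc _ ≤ 1 * |k - k'| :=
          mul_le_mul hc (abs_sqrt_one_add_sq_sub_le k k') (abs_nonneg _) zero_le_one
      _ = k' - k := by rw [one_mul, abs_sub_comm, abs_of_nonneg (by linarith)]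
  rw [abs_le] at hdiff
  constructor
  · refine le_csInf hne' fun y hy => ?_
    obtain ⟨x, hx⟩ := hne
    rcases le_or_gt x y with hxy | hxy
    · exact (csInf_le hbelow hx).trans hxy
    · refine csInf_le hbelow ?_
      have hs := optGain_le_optGain ha (hpos hy) hxy.le
      rw [mem_suboptNbhd_iff ha hα hθ, abs_le] at hx hy ⊢
      exact ⟨hy.1, by linarith [hx.2.1], by linarith [hy.2.2]⟩
  · refine csSup_le hne fun x hx => ?_
    obtain ⟨y, hy⟩ := hne'
    rcases le_or_gt x y with hxy | hxy
    · exact hxy.trans (le_csSup habove hy)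
    · refine le_csSup habove ?_
      have hs := optGain_le_optGain ha (hpos hy) hxy.le
      rw [mem_suboptNbhd_iff ha hα hθ, abs_le] at hx hy ⊢
      exact ⟨hx.1, by linarith [hx.2.1], by linarith [hy.2.2]⟩
end

section
/- Fix a > 0 and b > 0. The closed-loop cost k ↦ J_{a,b}(k) = (1 + k²)/(−2(a + b·k)) is quasiconvex on the domain { k ∈ ℝ : a + b·k < 0 } = (−∞, −a/b), and it is not monotonic on this domain: it attains a unique minimum at an interior point of the domain. -/
theorem stmt8 (a b : ℝ) (ha : 0 < a) (hb : 0 < b) :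
    QuasiconvexOn ℝ (Set.Iio (-a / b)) (fun k => (1 + k^2) / (-2 * (a + b * k))) ∧
    ∃ k₀ ∈ Set.Iio (-a / b),
      (∀ k ∈ Set.Iio (-a / b),
        (1 + k₀^2) / (-2 * (a + b * k₀)) ≤ (1 + k^2) / (-2 * (a + b * k))) ∧
      ∀ k ∈ Set.Iio (-a / b),
        (1 + k^2) / (-2 * (a + b * k)) = (1 + k₀^2) / (-2 * (a + b * k₀)) → k = k₀ := by
  have hpos : ∀ k ∈ Set.Iio (-a / b), 0 < -2 * (a + b * k) := by
    intro k hk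
    have h := (lt_div_iff₀ hb).1 (Set.mem_Iio.1 hk)
    linarith
  constructor
  · intro r x hx y hy s t hs ht hst
    obtain ⟨hxd, hx⟩ := hx
    obtain ⟨hyd, hy⟩ := hy
    have hd := convex_Iio (𝕜 := ℝ) (-a / b) hxd hyd hs ht hst
    refine ⟨hd, ?_⟩
    have hx' := (div_le_iff₀ (hpos x hxd)).1 hx
    have hy' := (div_le_iff₀ (hpos y hyd)).1 hy
    refine (div_le_iff₀ (hpos _ hd)).2 ?_
    simp only [smul_eq_mul]
    obtain rfl : t = 1 - s := by linarith
    have h1 := mul_le_mul_of_nonneg_left hx' hs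
    have h2 := mul_le_mul_of_nonneg_left hy' ht
    have h3 := mul_nonneg (mul_nonneg hs ht) (sq_nonneg (x - y))
    linarith
  · set s := √(a ^ 2 + b ^ 2) with hs
    have hs2 : s ^ 2 = a ^ 2 + b ^ 2 := Real.sq_sqrt (by positivity)
    have hs0 : 0 < s := Real.sqrt_pos.2 (by positivity)
    obtain ⟨k₀, hk₀⟩ : ∃ k₀, k₀ = (-a - s) / b := ⟨_, rfl⟩
    have hbk : b * k₀ = -a - s := by rw [hk₀]; field_simp
    have hmem : k₀ ∈ Set.Iio (-a / b) := by
      rw [Set.mem_Iio, hk₀]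
      gcongr
      linarith
    have hcrit : b * k₀ ^ 2 + 2 * a * k₀ - b = 0 := by
      refine (mul_eq_zero.1 ?_).resolve_left hb.ne'
      calc b * (b * k₀ ^ 2 + 2 * a * k₀ - b) = (b * k₀) ^ 2 + 2 * a * (b * k₀) - b ^ 2 := by ring
        _ = 0 := by rw [hbk]; linear_combination hs2
    have hval : (1 + k₀ ^ 2) / (-2 * (a + b * k₀)) = -k₀ / b := by
      rw [div_eq_div_iff (hpos k₀ hmem).ne' hb.ne']
      linear_combination -hcrit
    have hgap : ∀ k ∈ Set.Iio (-a / b),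
        (1 + k ^ 2) / (-2 * (a + b * k)) - -k₀ / b = (k - k₀) ^ 2 / (-2 * (a + b * k)) := by
      intro k hk
      rw [div_sub_div _ _ (hpos k hk).ne' hb.ne',
        div_eq_div_iff (mul_pos (hpos k hk) hb).ne' (hpos k hk).ne']
      linear_combination (2 * (a + b * k)) * hcrit
    refine ⟨k₀, hmem, fun k hk => ?_, fun k hk h => ?_⟩
    · rw [hval, ← sub_nonneg, hgap k hk]
      exact div_nonneg (sq_nonneg _) (hpos k hk).le
    · rw [hval, ← sub_eq_zero, hgap k hk, div_eq_zero_iff] at h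
      exact sub_eq_zero.1 (pow_eq_zero_iff two_ne_zero |>.1 (h.resolve_right (hpos k hk).ne'))
end

section
/- For a > 0 and b > 0, the minimum of (1 + k²)/(−2(a + b·k)) over all k with a + b·k < 0 equals (a + √(a² + b²))/b², and it is attained uniquely at k* = −(a + √(a² + b²))/b. -/
theorem stmt9 (a b : ℝ) (ha : 0 < a) (hb : 0 < b) :
    let kstar : ℝ := -(a + Real.sqrt (a^2 + b^2)) / b
    a + b * kstar < 0 ∧
    (1 + kstar^2) / (-2 * (a + b * kstar)) = (a + Real.sqrt (a^2 + b^2)) / b^2 ∧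
    ∀ k : ℝ, a + b * k < 0 →
      (a + Real.sqrt (a^2 + b^2)) / b^2 ≤ (1 + k^2) / (-2 * (a + b * k)) ∧
      ((1 + k^2) / (-2 * (a + b * k)) = (a + Real.sqrt (a^2 + b^2)) / b^2 → k = kstar) := by
  intro kstar
  have hs : 0 < Real.sqrt (a^2 + b^2) := Real.sqrt_pos.mpr (by positivity)
  have hsq : Real.sqrt (a^2 + b^2) ^ 2 = a^2 + b^2 := Real.sq_sqrt (by positivity)
  have hkstar : b * kstar = -(a + Real.sqrt (a^2 + b^2)) := by
    simp only [kstar]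
    field_simp
  clear_value kstar
  generalize Real.sqrt (a^2 + b^2) = s at *
  have key : ∀ k : ℝ, a + b * k < 0 →
      (1 + k^2) / (-2 * (a + b * k)) - (a + s) / b^2
        = (b * (k - kstar))^2 / (-2 * (a + b * k) * b^2) := by
    intro k hk
    have hne : -2 * (a + b * k) ≠ 0 := by linarith
    rw [div_sub_div _ _ hne (by positivity), mul_sub, hkstar]
    congr 1
    linear_combination -hsq
  have hneg : a + b * kstar < 0 := by linarith
  refine ⟨hneg, ?_, fun k hk => ⟨?_, fun h => ?_⟩⟩
  · have h := key kstar hneg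
    rw [sub_self, mul_zero, zero_pow two_ne_zero, zero_div] at h
    exact sub_eq_zero.mp h
  · have hpos : 0 < -2 * (a + b * k) := by linarith
    rw [← sub_nonneg, key k hk]
    positivity
  · have hpos : 0 < -2 * (a + b * k) := by linarith
    have h0 := key k hk
    rw [h, sub_self, eq_comm, div_eq_zero_iff] at h0
    have hden : -2 * (a + b * k) * b^2 ≠ 0 := by positivity
    have hmul := pow_eq_zero_iff two_ne_zero |>.mp (h0.resolve_right hden)
    exact sub_eq_zero.mp ((mul_eq_zero.mp hmul).resolve_left hb.ne')
end

section
/- Let a > 0 and k < −1, and set b := 2ak/(1 − k²) (which is positive). Then a + b·k < 0 and the controller k is optimal for b: (1 + k²)/(−2(a + b·k)) = (a + √(a² + b²))/b², i.e., the suboptimality ratio r(b, k) equals 1. -/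
theorem stmt11 (a k : ℝ) (ha : 0 < a) (hk : k < -1) :
    let b : ℝ := 2 * a * k / (1 - k^2)
    0 < b ∧ a + b * k < 0 ∧
    (1 + k^2) / (-2 * (a + b * k)) = (a + Real.sqrt (a^2 + b^2)) / b^2 := by
  intro b
  have hd : 1 - k^2 < 0 := by nlinarith
  have hd0 : 1 - k^2 ≠ 0 := hd.ne
  have hk0 : k ≠ 0 := by linarith
  have hp : 0 < 1 + k^2 := by positivity
  have hb : 0 < b := div_pos_of_neg_of_neg (by nlinarith) hd
  have hclosed : a + b * k = a * (1 + k^2) / (1 - k^2) := by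
    simp only [b]
    field_simp
    ring
  have hsqrt : Real.sqrt (a^2 + b^2) = -(a * (1 + k^2) / (1 - k^2)) := by
    have hsq : a^2 + b^2 = (-(a * (1 + k^2) / (1 - k^2)))^2 := by
      simp only [b]
      field_simp
      ring
    rw [hsq, Real.sqrt_sq]
    exact neg_nonneg.mpr (div_nonpos_of_nonneg_of_nonpos (by positivity) hd.le)
  refine ⟨hb, ?_, ?_⟩
  · rw [hclosed]
    exact div_neg_of_pos_of_neg (by positivity) hd
  · rw [hsqrt, hclosed]
    simp only [b]
    field_simp
    ring
end

section
/- Let a > 0 and α > 1, and let k < k′ < −1. If the sublevel set { b > 0 : a + b·k < 0 and ((1 + k²)·b²)/(−2(a + b·k)(a + √(a² + b²))) ≤ α } is unbounded above, then the corresponding sublevel set for k′, namely { b > 0 : a + b·k′ < 0 and ((1 + k′²)·b²)/(−2(a + b·k′)(a + √(a² + b²))) ≤ α }, is also unbounded above. -/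
/-- For large `b`, the suboptimality ratio at `b` does not increase when the gain moves from `k`
to some `k'` with `k < k' < -1`. -/
theorem suboptimality_ratio_le {a b k k' : ℝ} (ha : 0 < a) (hkk' : k < k') (hk' : k' < -1)
    (hab : a ≤ b) (hb : -a * (k + k') ≤ b * (k * k' - 1)) :
    ((1 + k'^2) * b^2) / (-2 * (a + b * k') * (a + Real.sqrt (a^2 + b^2))) ≤
      ((1 + k^2) * b^2) / (-2 * (a + b * k) * (a + Real.sqrt (a^2 + b^2))) := by
  have hs : 0 < a + Real.sqrt (a^2 + b^2) := by positivity
  have h1 : 0 < -2 * (a + b * k') := by nlinarith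
  have h2 : 0 < -2 * (a + b * k) := by nlinarith
  rw [div_le_div_iff₀ (mul_pos h1 hs) (mul_pos h2 hs)]
  have key : (1 + k'^2) * (-2 * (a + b * k)) ≤ (1 + k^2) * (-2 * (a + b * k')) := by
    nlinarith [mul_le_mul_of_nonneg_left hb (sub_pos.2 hkk').le]
  have := mul_le_mul_of_nonneg_right key (mul_nonneg (sq_nonneg b) hs.le)
  linarith

theorem stmt14 (a α k k' : ℝ) (ha : 0 < a) (hα : 1 < α) (hkk' : k < k') (hk' : k' < -1)
    (hub : ¬ BddAbove { b : ℝ | 0 < b ∧ a + b * k < 0 ∧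
      ((1 + k^2) * b^2) / (-2 * (a + b * k) * (a + Real.sqrt (a^2 + b^2))) ≤ α }) :
    ¬ BddAbove { b : ℝ | 0 < b ∧ a + b * k' < 0 ∧
      ((1 + k'^2) * b^2) / (-2 * (a + b * k') * (a + Real.sqrt (a^2 + b^2))) ≤ α } := by
  rw [not_bddAbove_iff] at hub ⊢
  intro M
  obtain ⟨b, ⟨hb0, -, hr⟩, hb⟩ := hub (max M (max a (-a * (k + k') / (k * k' - 1))))
  rw [max_lt_iff, max_lt_iff] at hb
  obtain ⟨hM, hab, hq⟩ := hb
  have hpos : 0 < k * k' - 1 := by nlinarith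
  refine ⟨b, ⟨hb0, by nlinarith, ?_⟩, hM⟩
  exact (suboptimality_ratio_le ha hkk' hk' hab.le ((div_lt_iff₀ hpos).1 hq).le).trans hr
end

section
/- Let n, m be positive integers, let A be a real n×n matrix and B a nonzero real n×m matrix, and suppose P* is a maximal positive semidefinite solution of the algebraic Riccati equation AᵀP + PA − P·B·Bᵀ·P + I = 0 (i.e., P* ⪰ 0 solves the equation and P* ⪰ P for every positive semidefinite solution P), with trace(P*) > 0. Then for every α > 1 there exist τ ∈ (0, 1/2) and a positive semidefinite matrix P solving the guaranteed-cost-control Riccati equation AᵀP + PA + P·((1/τ)·B₁B₁ᵀ − (1/(1+τ))·B·Bᵀ)·P + I = 0 with B₁ := τ·B ≠ 0, such that trace(P) ≤ α·trace(P*). -/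
open Matrix

open scoped Matrix.Norms.Operator MatrixOrder

/-- A nonzero symmetric matrix has a nonzero generalized eigenvalue relative to a positive definite
matrix. -/
theorem exists_ne_zero_mulVec_eq_smul_mulVec {n : ℕ} {P X : Matrix (Fin n) (Fin n) ℝ}
    (hP : P.PosDef) (hX : Xᵀ = X) (hX0 : X ≠ 0) :
    ∃ c : ℝ, c ≠ 0 ∧ ∃ x : Fin n → ℝ, x ≠ 0 ∧ X *ᵥ x = c • (P *ᵥ x) := by
  obtain ⟨C, hC⟩ := CStarAlgebra.nonneg_iff_eq_star_mul_self.mp hP.posSemidef.nonneg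
  have hC' : P = Cᵀ * C := by simpa [star_eq_conjTranspose] using hC
  have hCu : IsUnit C.det := by
    have h := hP.det_pos.ne'
    rw [hC', det_mul] at h
    exact isUnit_iff_ne_zero.mpr (right_ne_zero_of_mul h)
  have hCtu : IsUnit Cᵀ.det := by rwa [det_transpose]
  set Y : Matrix (Fin n) (Fin n) ℝ := Cᵀ⁻¹ * X * C⁻¹ with hY
  have hXY : X = Cᵀ * Y * C := by
    simp [hY, Matrix.mul_assoc, nonsing_inv_mul _ hCu, mul_nonsing_inv_cancel_left _ _ hCtu]
  have hYh : Y.IsHermitian := by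
    simp [IsHermitian, hY, transpose_nonsing_inv, hX, Matrix.mul_assoc]
  have hY0 : Y ≠ 0 := by
    rintro h
    exact hX0 (by simp [hXY, h])
  obtain ⟨v, t, ht, hv, hvt⟩ := hYh.exists_eigenvector_of_ne_zero hY0
  refine ⟨t, ht, C⁻¹ *ᵥ v, fun h => hv ?_, ?_⟩
  · simpa [mulVec_mulVec, mul_nonsing_inv _ hCu] using congrArg (C *ᵥ ·) h
  · rw [hXY, hC']
    simp only [mulVec_mulVec, Matrix.mul_assoc, mul_nonsing_inv _ hCu, Matrix.mul_one]
    rw [← mulVec_mulVec, hvt, mulVec_smul]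

/-- The Lyapunov operator of a matrix with a strict quadratic Lyapunov function is injective on
symmetric matrices. -/
theorem eq_zero_of_lyapunov_eq_zero {n : ℕ} {F P X : Matrix (Fin n) (Fin n) ℝ}
    (hP : P.PosDef) (hF : ∀ x : Fin n → ℝ, x ≠ 0 → x ⬝ᵥ ((Fᵀ * P + P * F) *ᵥ x) < 0)
    (hX : Xᵀ = X) (h : Fᵀ * X + X * F = 0) : X = 0 := by
  by_contra hX0
  obtain ⟨c, hc, x, hx, hXx⟩ := exists_ne_zero_mulVec_eq_smul_mulVec hP hX hX0
  have key (Z : Matrix (Fin n) (Fin n) ℝ) (hZ : Zᵀ = Z) :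
      x ⬝ᵥ ((Fᵀ * Z + Z * F) *ᵥ x) = 2 * ((F *ᵥ x) ⬝ᵥ (Z *ᵥ x)) := by
    have h1 : x ⬝ᵥ ((Fᵀ * Z) *ᵥ x) = (F *ᵥ x) ⬝ᵥ (Z *ᵥ x) := by
      rw [← mulVec_mulVec, dotProduct_mulVec, vecMul_transpose]
    have h2 : x ⬝ᵥ ((Z * F) *ᵥ x) = (F *ᵥ x) ⬝ᵥ (Z *ᵥ x) := by
      rw [← mulVec_mulVec, dotProduct_mulVec, ← mulVec_transpose, hZ, dotProduct_comm]
    rw [add_mulVec, dotProduct_add, h1, h2, two_mul]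
  have hPt : Pᵀ = P := by simpa using hP.isHermitian.eq
  have h1 := key X hX
  have h2 := hF x hx
  rw [key P hPt] at h2
  rw [h, hXx, zero_mulVec, dotProduct_zero, dotProduct_smul, smul_eq_mul] at h1
  have h3 : (F *ᵥ x) ⬝ᵥ (P *ᵥ x) ≠ 0 := by linarith
  exact mul_ne_zero two_ne_zero (mul_ne_zero hc h3) h1.symm

theorem eventually_forall_dotProduct_mulVec_pos {n : ℕ} {P : Matrix (Fin n) (Fin n) ℝ}
    (hP : P.PosDef) :
    ∀ᶠ R in nhds P, ∀ x : Fin n → ℝ, x ≠ 0 → 0 < x ⬝ᵥ (R *ᵥ x) := by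
  have hcont : Continuous fun z : Matrix (Fin n) (Fin n) ℝ × (Fin n → ℝ) =>
      z.2 ⬝ᵥ (z.1 *ᵥ z.2) := by fun_prop
  have h := (isCompact_sphere (0 : Fin n → ℝ) 1).eventually_forall_of_forall_eventually (x₀ := P)
    (P := fun R x => 0 < x ⬝ᵥ (R *ᵥ x)) (fun x hx => by
      have hx0 : x ≠ 0 := ne_zero_of_mem_unit_sphere ⟨x, hx⟩
      exact hcont.continuousAt.eventually_const_lt
        (by simpa using hP.dotProduct_mulVec_pos hx0))
  filter_upwards [h] with R hR x hx
  have hx' : 0 < ‖x‖ := norm_pos_iff.mpr hx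
  have := hR (‖x‖⁻¹ • x) (by simp [norm_smul, hx'.ne'])
  simp only [mulVec_smul, smul_dotProduct, dotProduct_smul, smul_eq_mul] at this
  have h0 : 0 < ‖x‖⁻¹ := inv_pos.mpr hx'
  exact (mul_pos_iff_of_pos_left h0).mp ((mul_pos_iff_of_pos_left h0).mp this)

/-- Symmetric solutions of a Riccati equation that are positive definite with a strict Lyapunov
inequality for the closed loop persist under small perturbations of the constant term. -/
theorem eventually_exists_riccati_solution {n : ℕ} {A M P : Matrix (Fin n) (Fin n) ℝ}
    (hM : Mᵀ = M) (hP : P.PosDef)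
    (hF : ∀ x : Fin n → ℝ, x ≠ 0 →
      x ⬝ᵥ (((A - M * P)ᵀ * P + P * (A - M * P)) *ᵥ x) < 0)
    {U : Set (Matrix (Fin n) (Fin n) ℝ)} (hU : U ∈ nhds P) :
    ∀ᶠ Y in nhds (Aᵀ * P + P * A - P * M * P), Yᵀ = Y →
      ∃ R ∈ U, Rᵀ = R ∧ Aᵀ * R + R * A - R * M * R = Y := by
  have hPt : Pᵀ = P := by simpa using hP.isHermitian.eq
  let sL : Matrix (Fin n) (Fin n) ℝ →ₗ[ℝ] Matrix (Fin n) (Fin n) ℝ :=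
    (1 / 2 : ℝ) • (LinearMap.id + (transposeLinearEquiv (Fin n) (Fin n) ℝ ℝ).toLinearMap)
  let s := LinearMap.toContinuousLinearMap sL
  have s_apply (X) : s X = (1 / 2 : ℝ) • (X + Xᵀ) := rfl
  have s_symm (X) : (s X)ᵀ = s X := by
    rw [s_apply, transpose_smul, transpose_add, transpose_transpose, add_comm]
  have sub_s (X) : (X - s X)ᵀ = -(X - s X) := by
    rw [transpose_sub, s_symm, s_apply]
    module
  have s_fix {X} (hX : Xᵀ = X) : s X = X := by
    rw [s_apply, hX]
    module
  have W_eq_zero {W X : Matrix (Fin n) (Fin n) ℝ} (hW : Wᵀ = W) (h : W + (X - s X) = 0) :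
      W = 0 ∧ s X = X := by
    have h' := congrArg transpose h
    rw [transpose_add, hW, sub_s, transpose_zero] at h'
    have hW0 : W = 0 := by
      have : (2 : ℝ) • W = (W + (X - s X)) + (W + -(X - s X)) := by module
      rw [h, h', add_zero] at this
      simpa using this
    refine ⟨hW0, ?_⟩
    rw [hW0, zero_add, sub_eq_zero] at h
    exact h.symm
  let H : Matrix (Fin n) (Fin n) ℝ → Matrix (Fin n) (Fin n) ℝ := fun X =>
    Aᵀ * s X + s X * A - s X * M * s X + (X - s X)
  have hs : HasStrictFDerivAt (fun X => s X) s P := s.hasStrictFDerivAt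
  have hH := (((hs.const_mul Aᵀ).add (hs.mul_const' A)).sub ((hs.mul_const' M).mul' hs)).add
    ((hasStrictFDerivAt_id P).sub hs)
  have hsurj : ∀ L : Matrix (Fin n) (Fin n) ℝ →L[ℝ] Matrix (Fin n) (Fin n) ℝ,
      (∀ Z, L Z = Aᵀ * s Z + s Z * A - (s P * M * s Z + s Z * M * s P) + (Z - s Z)) →
      L.range = ⊤ := by
    intro L hL
    refine LinearMap.range_eq_top.mpr (LinearMap.injective_iff_surjective.mp ?_)
    refine (injective_iff_map_eq_zero _).mpr fun Z hZ => ?_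
    have hZ' := (hL Z).symm.trans hZ
    rw [s_fix hPt] at hZ'
    obtain ⟨hW, hsZ⟩ := W_eq_zero (by
      simp only [transpose_sub, transpose_add, transpose_mul, s_symm, hPt, hM, transpose_transpose,
        Matrix.mul_assoc]
      abel) hZ'
    rw [← hsZ]
    refine eq_zero_of_lyapunov_eq_zero hP hF (s_symm Z) ?_
    rw [← hW]
    simp only [transpose_sub, transpose_mul, hPt, hM]
    noncomm_ring
  have hmap := hH.map_nhds_eq_of_surj (hsurj _ fun Z => rfl)
  have hHP : H P = Aᵀ * P + P * A - P * M * P := by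
    simp [H, s_fix hPt]
  have himg : H '' U ∈ nhds (H P) := by
    have := Filter.image_mem_map (m := H) hU
    exact hmap ▸ this
  rw [hHP] at himg
  filter_upwards [himg] with Y ⟨R, hRU, hRY⟩ hY
  obtain ⟨hW, hsR⟩ := W_eq_zero
    (W := Aᵀ * s R + s R * A - s R * M * s R - Y) (X := R) (by
      simp only [transpose_sub, transpose_add, transpose_mul, s_symm, hM, hY, transpose_transpose,
        Matrix.mul_assoc]
      abel) (by rw [← sub_eq_zero.mpr hRY]; simp only [H]; abel)
  rw [hsR] at hW
  exact ⟨R, hRU, hsR ▸ s_symm R, sub_eq_zero.mp hW⟩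

theorem stmt16 (n m : ℕ) (hn : 0 < n) (hm : 0 < m)
    (A : Matrix (Fin n) (Fin n) ℝ) (B : Matrix (Fin n) (Fin m) ℝ) (hB : B ≠ 0)
    (Pstar : Matrix (Fin n) (Fin n) ℝ) (hPsd : Pstar.PosSemidef)
    (hric : Aᵀ * Pstar + Pstar * A - Pstar * B * Bᵀ * Pstar + 1 = 0)
    (hmax : ∀ P : Matrix (Fin n) (Fin n) ℝ, P.PosSemidef →
      Aᵀ * P + P * A - P * B * Bᵀ * P + 1 = 0 → (Pstar - P).PosSemidef)
    (htr : 0 < Pstar.trace) :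
    ∀ α : ℝ, 1 < α → ∃ τ : ℝ, τ ∈ Set.Ioo (0:ℝ) (1/2) ∧
      ∃ P : Matrix (Fin n) (Fin n) ℝ, P.PosSemidef ∧
        Aᵀ * P + P * A +
          P * ((1 / τ) • ((τ • B) * (τ • B)ᵀ) - (1 / (1 + τ)) • (B * Bᵀ)) * P + 1 = 0 ∧
        τ • B ≠ 0 ∧ P.trace ≤ α * Pstar.trace := by
  intro α hα
  have hPt : Pstarᵀ = Pstar := by simpa using hPsd.isHermitian.eq
  have hPd : Pstar.PosDef := by
    refine .of_dotProduct_mulVec_pos hPsd.isHermitian fun x hx => ?_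
    refine lt_of_le_of_ne (hPsd.dotProduct_mulVec_nonneg x) fun h0 => hx ?_
    have hPx := (hPsd.dotProduct_mulVec_zero_iff x).mp h0.symm
    have h := congrArg (fun Z => x ⬝ᵥ (Z *ᵥ x)) hric
    have h1 : x ⬝ᵥ ((Pstar * A) *ᵥ x) = 0 := by
      rw [← mulVec_mulVec, dotProduct_mulVec, ← mulVec_transpose, hPt, hPx, zero_dotProduct]
    simp only [add_mulVec, sub_mulVec, dotProduct_add, dotProduct_sub, h1] at h
    simpa [← mulVec_mulVec, hPx] using h
  set M : Matrix (Fin n) (Fin n) ℝ := B * Bᵀ with hM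
  have hMt : Mᵀ = M := by simp [hM]
  have hric' : Aᵀ * Pstar + Pstar * A - Pstar * M * Pstar = -1 := by
    rw [hM, ← Matrix.mul_assoc]
    exact eq_neg_of_add_eq_zero_left hric
  have hF : ∀ x : Fin n → ℝ, x ≠ 0 →
      x ⬝ᵥ (((A - M * Pstar)ᵀ * Pstar + Pstar * (A - M * Pstar)) *ᵥ x) < 0 := by
    intro x hx
    have h1 : (A - M * Pstar)ᵀ * Pstar + Pstar * (A - M * Pstar) =
        -(1 + (Bᵀ * Pstar)ᵀ * (Bᵀ * Pstar)) := by
      rw [neg_add, ← hric']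
      simp only [transpose_sub, transpose_mul, hPt, transpose_transpose, hM,
        Matrix.mul_assoc, Matrix.sub_mul, Matrix.mul_sub]
      abel
    rw [h1, neg_mulVec, dotProduct_neg, neg_lt_zero, add_mulVec, dotProduct_add, one_mulVec]
    have h2 : 0 < x ⬝ᵥ x := by simpa using dotProduct_star_self_pos_iff.mpr hx
    have h3 := (posSemidef_conjTranspose_mul_self (Bᵀ * Pstar)).dotProduct_mulVec_nonneg x
    simp only [conjTranspose_eq_transpose_of_trivial, star_trivial] at h3
    linarith
  obtain ⟨β, hβ1, hβα⟩ := exists_between hα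
  have htrU : ∀ᶠ R in nhds Pstar, trace R < β * Pstar.trace := by
    have hc : Continuous fun R : Matrix (Fin n) (Fin n) ℝ => trace R := by fun_prop
    exact hc.continuousAt.eventually_lt_const (by nlinarith)
  have hsol := eventually_exists_riccati_solution hMt hPd hF
    ((eventually_forall_dotProduct_mulVec_pos hPd).and htrU)
  rw [hric'] at hsol
  have hlim : Filter.Tendsto (fun τ : ℝ => 1 / (1 + τ) - τ) (nhdsWithin 0 (Set.Ioi 0)) (nhds 1) := by
    have : ContinuousAt (fun τ : ℝ => 1 / (1 + τ) - τ) 0 := by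
      refine ContinuousAt.sub (ContinuousAt.div ?_ ?_ ?_) ?_ <;> first | fun_prop | norm_num
    have h := this.tendsto.mono_left (nhdsWithin_le_nhds (s := Set.Ioi 0))
    simpa using h
  have hlim' : Filter.Tendsto (fun τ : ℝ => -((1 / (1 + τ) - τ) • (1 : Matrix (Fin n) (Fin n) ℝ)))
      (nhdsWithin 0 (Set.Ioi 0)) (nhds (-1)) := by
    simpa using (hlim.smul_const (1 : Matrix (Fin n) (Fin n) ℝ)).neg
  have hpos := hlim.eventually_const_lt (u := β / α) ((div_lt_one (by linarith)).mpr hβα)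
  have hIoo : ∀ᶠ τ in nhdsWithin (0 : ℝ) (Set.Ioi 0), τ ∈ Set.Ioo (0 : ℝ) (1 / 2) :=
    Ioo_mem_nhdsGT (by norm_num)
  obtain ⟨τ, hτ, hsτ, hτs⟩ := (hIoo.and (hpos.and (hlim'.eventually hsol))).exists
  obtain ⟨R, ⟨hRpos, hRtr⟩, hRt, hR⟩ := hτs (by simp)
  set s : ℝ := 1 / (1 + τ) - τ with hs
  have hα0 : 0 < α := by linarith
  have hs0 : 0 < s := lt_trans (by positivity) hsτ
  refine ⟨τ, hτ, s⁻¹ • R, ?_, ?_, smul_ne_zero hτ.1.ne' hB, ?_⟩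
  · refine PosSemidef.smul (.of_dotProduct_mulVec_nonneg (by simpa [IsHermitian] using hRt)
      fun x => ?_) (inv_nonneg.mpr hs0.le)
    rcases eq_or_ne x 0 with rfl | hx
    · simp
    · simpa using (hRpos x hx).le
  · have hcoef : (1 / τ) • ((τ • B) * (τ • B)ᵀ) - (1 / (1 + τ)) • M = -(s • M) := by
      simp only [transpose_smul, Matrix.smul_mul, Matrix.mul_smul, smul_smul, ← hM]
      rw [hs, ← sub_smul, ← neg_smul]
      congr 1
      have := hτ.1.ne'
      field_simp
      ring
    rw [hcoef]
    have h1 : Aᵀ * (s⁻¹ • R) + (s⁻¹ • R) * A + (s⁻¹ • R) * -(s • M) * (s⁻¹ • R) =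
        s⁻¹ • (Aᵀ * R + R * A - R * M * R) := by
      simp only [Matrix.smul_mul, Matrix.mul_smul, Matrix.mul_neg, Matrix.neg_mul, smul_smul,
        smul_add, smul_neg, sub_eq_add_neg, mul_inv_cancel₀ hs0.ne', mul_one]
    rw [h1, hR, smul_neg, smul_smul, inv_mul_cancel₀ hs0.ne', one_smul, neg_add_cancel]
  · rw [trace_smul, smul_eq_mul, inv_mul_le_iff₀ hs0]
    have h2 : β < s * α := (div_lt_iff₀ hα0).mp hsτ
    nlinarith
end

section
/- Let a > 0, θ > 0, and α ≥ 1. There is no finite set 𝒞 ⊆ ℝ that is an α-suboptimal cover of the set B = [−θ, 0) ∪ (0, θ]; that is, for every finite 𝒞 ⊆ ℝ there exists b ∈ B such that every k ∈ 𝒞 fails to satisfy both a + b·k < 0 and (1 + k²)/(−2(a + b·k)) ≤ α·(a + √(a² + b²))/b². -/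
/-- A small enough positive `b` is stabilized by no controller of a given finite set. -/
theorem exists_pos_le_forall_add_mul_pos {a θ : ℝ} (ha : 0 < a) (hθ : 0 < θ) (𝒞 : Finset ℝ) :
    ∃ b, 0 < b ∧ b ≤ θ ∧ ∀ k ∈ 𝒞, 0 < a + b * k := by
  set M : ℝ := ∑ k ∈ 𝒞, |k|
  have hM : 0 ≤ M := Finset.sum_nonneg fun k _ => abs_nonneg k
  have hM1 : 0 < M + 1 := by linarith
  have hb : 0 < min θ (a / (M + 1)) := lt_min hθ (div_pos ha hM1)
  refine ⟨min θ (a / (M + 1)), hb, min_le_left _ _, fun k hk => ?_⟩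
  have hkM : |k| ≤ M := Finset.single_le_sum (f := fun x : ℝ => |x|) (fun x _ => abs_nonneg x) hk
  have hbM : min θ (a / (M + 1)) * (M + 1) ≤ a := (le_div_iff₀ hM1).1 (min_le_right _ _)
  nlinarith [neg_abs_le k]

theorem stmt17 (a θ α : ℝ) (ha : 0 < a) (hθ : 0 < θ) (hα : 1 ≤ α) :
    ∀ 𝒞 : Finset ℝ, ∃ b ∈ Set.Ico (-θ) (0:ℝ) ∪ Set.Ioc (0:ℝ) θ,
      ∀ k ∈ 𝒞, ¬ (a + b * k < 0 ∧ scalarJ a b k ≤ α * scalarJStar a b) := by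
  intro 𝒞
  obtain ⟨b, hb, hbθ, h⟩ := exists_pos_le_forall_add_mul_pos ha hθ 𝒞
  exact ⟨b, Or.inr ⟨hb, hbθ⟩, fun k hk hJ => (h k hk).not_gt hJ.1⟩
end

section
/- For every a > 0, every α > 1, and every θ ≥ 1, there exists a finite set 𝒞 ⊆ ℝ that is an α-suboptimal cover of the interval [1/θ, 1]; that is, the α-suboptimal covering number of [1/θ, 1] is finite. -/
/-- The Riccati gain stabilizes the system and attains the optimal cost. -/
theorem scalarJ_optimal_gain {a b : ℝ} (ha : 0 < a) (hb : 0 < b) :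
    a + b * -(b * scalarJStar a b) < 0 ∧
      scalarJ a b (-(b * scalarJStar a b)) = scalarJStar a b := by
  have hs : 0 < √(a ^ 2 + b ^ 2) := Real.sqrt_pos.2 (by positivity)
  have hsq : √(a ^ 2 + b ^ 2) ^ 2 = a ^ 2 + b ^ 2 := Real.sq_sqrt (by positivity)
  have hP : b ^ 2 * scalarJStar a b = a + √(a ^ 2 + b ^ 2) := by
    unfold scalarJStar
    field_simp
  set P := scalarJStar a b
  set s := √(a ^ 2 + b ^ 2)
  have hgap : a + b * -(b * P) = -s := by linear_combination -hP
  refine ⟨by linarith, ?_⟩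
  have hric : 1 + (b * P) ^ 2 = 2 * s * P := by
    have h : b ^ 2 * (1 + (b * P) ^ 2) = b ^ 2 * (2 * s * P) := by
      linear_combination (b ^ 2 * P + a - s) * hP - hsq
    exact mul_left_cancel₀ (by positivity) h
  rw [scalarJ, hgap, div_eq_iff (by linarith)]
  linear_combination hric

/-- A controller that is strictly better than `α`-suboptimal at `b₀` covers a neighbourhood. -/
theorem eventually_suboptimal {a α b₀ k : ℝ} (hb₀ : b₀ ≠ 0) (hstab : a + b₀ * k < 0)
    (hlt : scalarJ a b₀ k < α * scalarJStar a b₀) :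
    ∀ᶠ b in nhds b₀, a + b * k < 0 ∧ scalarJ a b k ≤ α * scalarJStar a b := by
  have hden : -2 * (a + b₀ * k) ≠ 0 := by linarith
  have hgap : ContinuousAt (fun b => a + b * k) b₀ := by fun_prop
  have hJ : ContinuousAt (fun b => scalarJ a b k) b₀ := by
    unfold scalarJ
    fun_prop (disch := exact hden)
  have hJStar : ContinuousAt (fun b => α * scalarJStar a b) b₀ := by
    unfold scalarJStar
    fun_prop (disch := exact pow_ne_zero 2 hb₀)
  filter_upwards [hgap.eventually_lt continuousAt_const hstab,
    hJ.eventually_lt hJStar hlt] with b h₁ h₂ using ⟨h₁, h₂.le⟩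

theorem stmt18 (a α θ : ℝ) (ha : 0 < a) (hα : 1 < α) (hθ : 1 ≤ θ) :
    ∃ 𝒞 : Finset ℝ, IsSuboptCover a α (Set.Icc (1 / θ) 1) 𝒞 := by
  refine isCompact_Icc.induction_on (p := fun s => ∃ C, IsSuboptCover a α s C)
    ⟨∅, fun b hb => hb.elim⟩ ?_ ?_ ?_
  · rintro s t hst ⟨C, hC⟩
    exact ⟨C, fun b hb => hC b (hst hb)⟩
  · classical
    rintro s t ⟨C, hC⟩ ⟨D, hD⟩
    refine ⟨C ∪ D, ?_⟩
    rintro b (hb | hb)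
    · obtain ⟨k, hk, h⟩ := hC b hb
      exact ⟨k, Finset.mem_union_left D hk, h⟩
    · obtain ⟨k, hk, h⟩ := hD b hb
      exact ⟨k, Finset.mem_union_right C hk, h⟩
  · intro b₀ hb₀
    have hpos : 0 < b₀ := lt_of_lt_of_le (by positivity) hb₀.1
    have hJStar : 0 < scalarJStar a b₀ := by
      unfold scalarJStar
      positivity
    obtain ⟨hstab, hopt⟩ := scalarJ_optimal_gain ha hpos
    have hlt : scalarJ a b₀ (-(b₀ * scalarJStar a b₀)) < α * scalarJStar a b₀ := by
      rw [hopt]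
      exact lt_mul_of_one_lt_left hJStar hα
    exact ⟨_, mem_nhdsWithin_of_mem_nhds (eventually_suboptimal hpos.ne' hstab hlt),
      {-(b₀ * scalarJStar a b₀)}, fun b hb => ⟨_, Finset.mem_singleton_self _, hb⟩⟩
end

section
/- Let a > 0 and α ≥ (2a+1)/(2a). Then there exist β ∈ (0, 1), τ > 0, and p > 0 such that (((1−β)/2)²/τ − ((1+β)/2)²/(1+τ))·p² + 2a·p + 1 = 0 and p ≤ 2aα; that is, the scalar GCC Riccati equation with parameters (a, (1−β)/2, (1+β)/2, 1) has a solution whose value is at most α times the lower bound 2a on the optimal cost at b = 1. -/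
theorem stmt19 (a α : ℝ) (ha : 0 < a) (hα : (2 * a + 1) / (2 * a) ≤ α) :
    ∃ β ∈ Set.Ioo (0:ℝ) 1, ∃ τ : ℝ, 0 < τ ∧ ∃ p : ℝ, 0 < p ∧
      (((1 - β) / 2)^2 / τ - ((1 + β) / 2)^2 / (1 + τ)) * p^2 + 2 * a * p + 1 = 0 ∧
      p ≤ 2 * a * α := by
  have hd : 0 < 8 * a ^ 2 + 7 * a + 2 := by positivity
  obtain ⟨e, he⟩ : ∃ e, e = a / (8 * a ^ 2 + 7 * a + 2) := ⟨_, rfl⟩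
  have he0 : 0 < e := by rw [he]; positivity
  have he1 : e < 1 / 2 := by
    rw [he, div_lt_iff₀ hd]
    nlinarith
  have hmul : e * (8 * a ^ 2 + 7 * a + 2) = a := by
    rw [he]; field_simp
  refine ⟨1 - 2 * e, ⟨by linarith, by linarith⟩, e, he0, 2 * a + 1, by positivity, ?_, ?_⟩
  · have h1 : 1 + e ≠ 0 := by positivity
    have hcoef : ((1 - (1 - 2 * e)) / 2) ^ 2 / e - ((1 + (1 - 2 * e)) / 2) ^ 2 / (1 + e)
        = (3 * e - 1) / (1 + e) := by
      field_simp
      ring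
    rw [hcoef]
    field_simp
    linear_combination 2 * hmul
  · rw [div_le_iff₀ (by positivity)] at hα
    linarith
end
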